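/- The axiom ΔC is not valid on the class of (c)-frames: there exist a neighborhood model M = ⟨S, N, V⟩ whose neighborhood function at every state is closed under binary intersections, a state s, and a propositional variable p, such that M,s ⊨ Δp and M,s ⊨ Δ¬p but M,s ⊭ Δ(p ∧ ¬p). (A witness: S = {s,t}, N(s) = {{s}}, N(t) = ∅, V(p) = {s}.) -/

import Mathlib

/-- The language L(Δ) of contingency logic: φ ::= p | ¬φ | (φ ∧ φ) | Δφ. -/
inductive Formula (P : Type) : Type
  | atom : P → Formula P
  | neg : Formula P → Formula P
  | and : Formula P → Formula P → Formula P
  | delta : Formula P → Formula P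

namespace Formula

variable {P : Type}

/-- φ ∨ ψ abbreviates ¬(¬φ ∧ ¬ψ). -/
def or (φ ψ : Formula P) : Formula P := neg (and (neg φ) (neg ψ))

/-- φ → ψ abbreviates ¬(φ ∧ ¬ψ). -/
def imp (φ ψ : Formula P) : Formula P := neg (and φ (neg ψ))

/-- φ ↔ ψ abbreviates (φ → ψ) ∧ (ψ → φ). -/
def iffF (φ ψ : Formula P) : Formula P := and (imp φ ψ) (imp ψ φ)

end Formula

/-- ⊤ : a fixed tautology (p ∨ ¬p for a fixed propositional variable p). -/
noncomputable def Formula.top (P : Type) [Nonempty P] : Formula P :=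
  Formula.or (Formula.atom (Classical.arbitrary P))
    (Formula.neg (Formula.atom (Classical.arbitrary P)))

/-- A neighborhood model ⟨S, N, V⟩: a nonempty set of states `S`, a neighborhood
function `N : S → P(P(S))` and a valuation `V`. -/
structure NbhdModel (P : Type) where
  S : Type
  nonempty : Nonempty S
  N : S → Set (Set S)
  V : P → Set S

/-- The truth set ⟦φ⟧ of a formula in a neighborhood model; the clause for `Δφ` says
that a state `s` satisfies `Δφ` iff ⟦φ⟧ ∈ N(s) or S ∖ ⟦φ⟧ ∈ N(s). -/
def NbhdModel.truthSet {P : Type} (M : NbhdModel P) : Formula P → Set M.S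
  | .atom p => M.V p
  | .neg φ => (M.truthSet φ)ᶜ
  | .and φ ψ => M.truthSet φ ∩ M.truthSet ψ
  | .delta φ => {s | M.truthSet φ ∈ M.N s ∨ (M.truthSet φ)ᶜ ∈ M.N s}

/-- Satisfaction: M,s ⊨ φ. -/
def NbhdModel.sat {P : Type} (M : NbhdModel P) (s : M.S) (φ : Formula P) : Prop :=
  s ∈ M.truthSet φ

/-- Frame property (m): closure under supersets. -/
def SupersetClosed {S : Type} (N : S → Set (Set S)) : Prop :=
  ∀ s : S, ∀ X Y : Set S, X ∈ N s → X ⊆ Y → Y ∈ N s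

/-- Frame property (c): closure under binary intersections. -/
def InterClosed {S : Type} (N : S → Set (Set S)) : Prop :=
  ∀ s : S, ∀ X Y : Set S, X ∈ N s → Y ∈ N s → X ∩ Y ∈ N s

/-- Frame property (n): contains the unit. -/
def ContainsUnit {S : Type} (N : S → Set (Set S)) : Prop :=
  ∀ s : S, (Set.univ : Set S) ∈ N s

/-- Frame property (z): closure under complements. -/
def ComplClosed {S : Type} (N : S → Set (Set S)) : Prop :=
  ∀ s : S, ∀ X : Set S, X ∈ N s → Xᶜ ∈ N s

/-- The supplementation of a neighborhood function:
`N⁺(s) = {X ⊆ S : Y ⊆ X for some Y ∈ N(s)}`. -/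
def suppN {S : Type} (N : S → Set (Set S)) (s : S) : Set (Set S) :=
  {X | ∃ Y ∈ N s, Y ⊆ X}

/-- the axiom ΔC is not valid on the class of (c)-frames: there exist a
(c)-model, a state s and a propositional variable p with M,s ⊨ Δp, M,s ⊨ Δ¬p, but
M,s ⊭ Δ(p ∧ ¬p). -/
theorem deltaC_not_valid_on_c_frames {P : Type} [Nonempty P] :
    ∃ (M : NbhdModel P) (s : M.S) (p : P),
      InterClosed M.N ∧
      M.sat s (Formula.delta (Formula.atom p)) ∧
      M.sat s (Formula.delta (Formula.neg (Formula.atom p))) ∧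
      ¬ M.sat s (Formula.delta (Formula.and (Formula.atom p)
          (Formula.neg (Formula.atom p)))) := by
  obtain ⟨p⟩ := (inferInstance : Nonempty P)
  refine ⟨⟨Bool, ⟨true⟩, fun s => {X | s = true ∧ X = {true}}, fun _ => {true}⟩,
    true, p, ?_, ?_, ?_, ?_⟩
  · rintro s X Y ⟨hs, rfl⟩ ⟨_, rfl⟩
    exact ⟨hs, Set.inter_self _⟩
  · exact Or.inl ⟨rfl, rfl⟩
  · exact Or.inr ⟨rfl, compl_compl _⟩
  · rintro (⟨_, h⟩ | ⟨_, h⟩)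
    · have h1 : true ∈ (({true} : Set Bool) ∩ ({true} : Set Bool)ᶜ) :=
        (Set.ext_iff.mp h true).mpr rfl
      exact h1.2 h1.1
    · have h1 : false ∈ ({true} : Set Bool) :=
        (Set.ext_iff.mp h false).mp (fun hf => hf.2 hf.1)
      simp at h1
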